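/- The two CCP solution triangles T1 and T2 share their Brocard circle, which is the circle having as diameter the segment from the incenter I of ABC to the Gergonne point Ge of ABC: the circle with diameter from the circumcenter of T1 to the symmedian point of T1 coincides with the circle with diameter from the circumcenter of T2 to the symmedian point of T2, and both coincide with the circle of center midpoint(I, Ge) and radius dist(I,Ge)/2 (assuming V1,V2,V3 and W1,W2,W3 are each affinely independent). -/

import Mathlib

open EuclideanGeometry

/-- The point with barycentric coordinates `[x : y : z]` with respect to `(A, B, C)`. -/
noncomputable def bary (A B C : EuclideanSpace ℝ (Fin 2)) (x y z : ℝ) :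
    EuclideanSpace ℝ (Fin 2) :=
  (x + y + z)⁻¹ • (x • A + y • B + z • C)

/-- The circle having segment `PQ` as diameter. -/
noncomputable def diamCircle (P Q : EuclideanSpace ℝ (Fin 2)) :
    Set (EuclideanSpace ℝ (Fin 2)) :=
  Metric.sphere (midpoint ℝ P Q) (dist P Q / 2)

/-- The point with barycentric coordinates `[p² / u : q² / v : (p + q)² / w]`; these points trace
out the inscribed conic whose perspector is `[1 / u : 1 / v : 1 / w]`. -/
noncomputable def inconicPoint (A B C : EuclideanSpace ℝ (Fin 2)) (u v w p q : ℝ) :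
    EuclideanSpace ℝ (Fin 2) :=
  bary A B C (p ^ 2 / u) (q ^ 2 / v) ((p + q) ^ 2 / w)

/-- The sum of the barycentric coordinates defining `inconicPoint`. -/
noncomputable def inconicForm (u v w p q : ℝ) : ℝ :=
  p ^ 2 / u + q ^ 2 / v + (p + q) ^ 2 / w

lemma inconicForm_pos {u v w p q : ℝ} (hu : 0 < u) (hv : 0 < v) (hw : 0 < w) (hp : p ≠ 0) :
    0 < inconicForm u v w p q := by
  unfold inconicForm
  positivity

lemma dist_sq_eq (X Y : EuclideanSpace ℝ (Fin 2)) :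
    dist X Y ^ 2 = (X 0 - Y 0) ^ 2 + (X 1 - Y 1) ^ 2 := by
  rw [EuclideanSpace.dist_eq, Real.sq_sqrt (by positivity)]
  simp [Fin.sum_univ_two, Real.dist_eq, sq_abs]

lemma bary_apply (A B C : EuclideanSpace ℝ (Fin 2)) (x y z : ℝ) (i : Fin 2) :
    bary A B C x y z i = (x + y + z)⁻¹ * (x * A i + y * B i + z * C i) := by
  simp [bary, mul_add]

lemma dist_bary_sq (A B C : EuclideanSpace ℝ (Fin 2)) {x y z x' y' z' : ℝ}
    (h : x + y + z ≠ 0) (h' : x' + y' + z' ≠ 0) :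
    dist (bary A B C x y z) (bary A B C x' y' z') ^ 2 =
      -(dist B C ^ 2 * (y / (x + y + z) - y' / (x' + y' + z')) *
            (z / (x + y + z) - z' / (x' + y' + z')) +
          dist C A ^ 2 * (z / (x + y + z) - z' / (x' + y' + z')) *
            (x / (x + y + z) - x' / (x' + y' + z')) +
          dist A B ^ 2 * (x / (x + y + z) - x' / (x' + y' + z')) *
            (y / (x + y + z) - y' / (x' + y' + z'))) := by
  have key : ∀ n n' : ℝ, n ≠ 0 → n' ≠ 0 → n = x + y + z → n' = x' + y' + z' → ∀ i : Fin 2,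
      n⁻¹ * (x * A i + y * B i + z * C i) - n'⁻¹ * (x' * A i + y' * B i + z' * C i) =
        (x / n - x' / n') * (A i - C i) + (y / n - y' / n') * (B i - C i) := by
    intro n n' hn hn' e e' i
    have hz : z = n - x - y := by linarith
    have hz' : z' = n' - x' - y' := by linarith
    subst hz hz'
    field_simp
    ring
  have hz : z / (x + y + z) - z' / (x' + y' + z') =
      -(x / (x + y + z) - x' / (x' + y' + z')) - (y / (x + y + z) - y' / (x' + y' + z')) := by
    field_simp
    ring
  simp only [dist_sq_eq, bary_apply, key _ _ h h' rfl rfl, hz]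
  ring

lemma dist_inconicPoint_sq {A B C : EuclideanSpace ℝ (Fin 2)} {u v w p q p' q' : ℝ}
    (hu : 0 < u) (hv : 0 < v) (hw : 0 < w)
    (ha : dist B C = v + w) (hb : dist C A = w + u) (hc : dist A B = u + v)
    (hp : p ≠ 0) (hp' : p' ≠ 0) :
    dist (inconicPoint A B C u v w p q) (inconicPoint A B C u v w p' q') ^ 2 =
      4 * (p * q' - p' * q) ^ 2 / (inconicForm u v w p q * inconicForm u v w p' q') := by
  have hS := inconicForm_pos (q := q) hu hv hw hp
  have hS' := inconicForm_pos (q := q') hu hv hw hp'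
  unfold inconicPoint
  unfold inconicForm at *
  rw [dist_bary_sq A B C hS.ne' hS'.ne', ha, hb, hc]
  have e : ∀ p q : ℝ, p ^ 2 / u + q ^ 2 / v + (p + q) ^ 2 / w =
      (p ^ 2 * v * w + q ^ 2 * u * w + (p + q) ^ 2 * u * v) / (u * v * w) := fun p q => by
    field_simp
  have hN : p ^ 2 * v * w + q ^ 2 * u * w + (p + q) ^ 2 * u * v ≠ 0 := by positivity
  have hN' : p' ^ 2 * v * w + q' ^ 2 * u * w + (p' + q') ^ 2 * u * v ≠ 0 := by positivity
  rw [e, e]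
  field_simp
  ring

lemma dist_inconicPoint_incenter_sq {A B C : EuclideanSpace ℝ (Fin 2)} {u v w p q : ℝ}
    (hu : 0 < u) (hv : 0 < v) (hw : 0 < w)
    (ha : dist B C = v + w) (hb : dist C A = w + u) (hc : dist A B = u + v) (hp : p ≠ 0) :
    dist (inconicPoint A B C u v w p q) (bary A B C (v + w) (w + u) (u + v)) ^ 2 =
      u * v * w / (u + v + w) := by
  have hS := inconicForm_pos (q := q) hu hv hw hp
  unfold inconicPoint
  unfold inconicForm at *
  rw [dist_bary_sq A B C hS.ne' (by positivity), ha, hb, hc]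
  have hsum : v + w + (w + u) + (u + v) = 2 * (u + v + w) := by ring
  have hS' : p ^ 2 / u + q ^ 2 / v + (p + q) ^ 2 / w =
    (p ^ 2 * v * w + q ^ 2 * u * w + (p + q) ^ 2 * u * v) / (u * v * w) := by
    field_simp
  have hN : p ^ 2 * v * w + q ^ 2 * u * w + (p + q) ^ 2 * u * v ≠ 0 := by positivity
  rw [hsum, hS']
  field_simp
  ring

lemma circumcenter_inconicPoint {A B C : EuclideanSpace ℝ (Fin 2)} {u v w : ℝ}
    {p q : Fin 3 → ℝ} (hu : 0 < u) (hv : 0 < v) (hw : 0 < w)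
    (ha : dist B C = v + w) (hb : dist C A = w + u) (hc : dist A B = u + v)
    (hp : ∀ i, p i ≠ 0) (T : Affine.Triangle ℝ (EuclideanSpace ℝ (Fin 2)))
    (hT : ∀ i, T.points i = inconicPoint A B C u v w (p i) (q i)) :
    T.circumcenter = bary A B C (v + w) (w + u) (u + v) := by
  have htop : affineSpan ℝ (Set.range T.points) = ⊤ := by
    rw [T.independent.affineSpan_eq_top_iff_card_eq_finrank_add_one]
    simp
  refine (T.eq_circumcenter_of_dist_eq (r := √(u * v * w / (u + v + w)))
    (htop ▸ AffineSubspace.mem_top ..) fun i => ?_).symm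
  rw [hT, ← dist_inconicPoint_incenter_sq (q := q i) hu hv hw ha hb hc (hp i),
    Real.sqrt_sq dist_nonneg]

/-- If the weighted sums of the squared parameters agree, then the symmedian point of a triangle
inscribed in the incircle is the Gergonne point. -/
lemma symmedian_inconicPoint {A B C : EuclideanSpace ℝ (Fin 2)}
    {u v w p₁ q₁ p₂ q₂ p₃ q₃ m : ℝ}
    (hu : 0 < u) (hv : 0 < v) (hw : 0 < w)
    (ha : dist B C = v + w) (hb : dist C A = w + u) (hc : dist A B = u + v)
    (hp₁ : p₁ ≠ 0) (hp₂ : p₂ ≠ 0) (hp₃ : p₃ ≠ 0) (hm : m ≠ 0)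
    (hp : (p₂ * q₃ - p₃ * q₂) ^ 2 * p₁ ^ 2 + (p₃ * q₁ - p₁ * q₃) ^ 2 * p₂ ^ 2 +
      (p₁ * q₂ - p₂ * q₁) ^ 2 * p₃ ^ 2 = m)
    (hq : (p₂ * q₃ - p₃ * q₂) ^ 2 * q₁ ^ 2 + (p₃ * q₁ - p₁ * q₃) ^ 2 * q₂ ^ 2 +
      (p₁ * q₂ - p₂ * q₁) ^ 2 * q₃ ^ 2 = m)
    (hr : (p₂ * q₃ - p₃ * q₂) ^ 2 * (p₁ + q₁) ^ 2 + (p₃ * q₁ - p₁ * q₃) ^ 2 * (p₂ + q₂) ^ 2 +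
      (p₁ * q₂ - p₂ * q₁) ^ 2 * (p₃ + q₃) ^ 2 = m)
    {V₁ V₂ V₃ : EuclideanSpace ℝ (Fin 2)} (hV₁ : V₁ = inconicPoint A B C u v w p₁ q₁)
    (hV₂ : V₂ = inconicPoint A B C u v w p₂ q₂) (hV₃ : V₃ = inconicPoint A B C u v w p₃ q₃) :
    bary V₁ V₂ V₃ (dist V₂ V₃ ^ 2) (dist V₃ V₁ ^ 2) (dist V₁ V₂ ^ 2) =
      bary A B C (1 / u) (1 / v) (1 / w) := by
  have hS₁ := inconicForm_pos (q := q₁) hu hv hw hp₁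
  have hS₂ := inconicForm_pos (q := q₂) hu hv hw hp₂
  have hS₃ := inconicForm_pos (q := q₃) hu hv hw hp₃
  have e : ∀ p q i, inconicPoint A B C u v w p q i = (inconicForm u v w p q)⁻¹ *
      (p ^ 2 / u * A i + q ^ 2 / v * B i + (p + q) ^ 2 / w * C i) := fun p q i => by
    rw [inconicPoint, bary_apply, inconicForm]
  have hsum : (p₂ * q₃ - p₃ * q₂) ^ 2 * inconicForm u v w p₁ q₁ +
      (p₃ * q₁ - p₁ * q₃) ^ 2 * inconicForm u v w p₂ q₂ +
      (p₁ * q₂ - p₂ * q₁) ^ 2 * inconicForm u v w p₃ q₃ = m * (1 / u + 1 / v + 1 / w) := by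
    unfold inconicForm
    linear_combination hp / u + hq / v + hr / w
  subst hV₁ hV₂ hV₃
  ext i
  rw [bary_apply, bary_apply, dist_inconicPoint_sq hu hv hw ha hb hc hp₂ hp₃,
    dist_inconicPoint_sq hu hv hw ha hb hc hp₃ hp₁,
    dist_inconicPoint_sq hu hv hw ha hb hc hp₁ hp₂, e, e, e]
  generalize inconicForm u v w p₁ q₁ = S₁ at *
  generalize inconicForm u v w p₂ q₂ = S₂ at *
  generalize inconicForm u v w p₃ q₃ = S₃ at *
  have hden : 4 * (p₂ * q₃ - p₃ * q₂) ^ 2 / (S₂ * S₃) + 4 * (p₃ * q₁ - p₁ * q₃) ^ 2 / (S₃ * S₁) +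
      4 * (p₁ * q₂ - p₂ * q₁) ^ 2 / (S₁ * S₂) =
      4 * m / (S₁ * S₂ * S₃) * (1 / u + 1 / v + 1 / w) := by
    rw [div_mul_eq_mul_div, mul_assoc, ← hsum]
    field_simp
  have hg : 1 / u + 1 / v + 1 / w ≠ 0 := by positivity
  have hk : 4 * m / (S₁ * S₂ * S₃) ≠ 0 := by positivity
  rw [hden, mul_inv, mul_comm (4 * m / (S₁ * S₂ * S₃))⁻¹, mul_assoc]
  congr 1
  rw [inv_mul_eq_iff_eq_mul₀ hk]
  trans 4 / (S₁ * S₂ * S₃) * (m / u * A i + m / v * B i + m / w * C i)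
  · nth_rewrite 1 [← hp]
    nth_rewrite 1 [← hq]
    rw [← hr]
    field_simp
    ring
  · ring

lemma dist_lt_dist_add_dist_of_affineIndependent {A B C : EuclideanSpace ℝ (Fin 2)}
    (h : AffineIndependent ℝ ![A, B, C]) : dist A C < dist A B + dist B C := by
  refine (dist_triangle A B C).lt_of_ne fun heq => ?_
  rw [affineIndependent_iff_not_collinear_set] at h
  exact h (dist_add_dist_eq_iff.mp heq.symm).collinear

/-- The two CCP solution triangles `T1` and `T2` share their Brocard circle (the circle on
the segment circumcenter–symmedian point as diameter), which is the circle having the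
segment from the incenter `I` to the Gergonne point `Ge` of `ABC` as diameter. -/
theorem ccp_solutions_share_brocard_circle
    (A B C : EuclideanSpace ℝ (Fin 2)) (hABC : AffineIndependent ℝ ![A, B, C])
    (a b c s u v w φ : ℝ)
    (ha : a = dist B C) (hb : b = dist C A) (hc : c = dist A B)
    (hs : s = (a + b + c) / 2)
    (hu : u = s - a) (hv : v = s - b) (hw : w = s - c)
    (hφ : φ = (1 + Real.sqrt 5) / 2)
    (I Ge : EuclideanSpace ℝ (Fin 2))
    (hI : I = bary A B C a b c)
    (hGe : Ge = bary A B C (1 / u) (1 / v) (1 / w))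
    (V1 V2 V3 : EuclideanSpace ℝ (Fin 2))
    (hV1 : V1 = bary A B C (φ ^ 2 / u) (1 / v) ((φ - 1) ^ 2 / w))
    (hV2 : V2 = bary A B C ((φ - 2) ^ 2 / u) (1 / v) ((φ - 1) ^ 2 / w))
    (hV3 : V3 = bary A B C ((φ - 2) ^ 2 / u) ((2 * φ - 3) ^ 2 / v) ((φ - 1) ^ 2 / w))
    (W1 W2 W3 : EuclideanSpace ℝ (Fin 2))
    (hW1 : W1 = bary A B C (1 / u) (φ ^ 2 / v) ((φ + 1) ^ 2 / w))
    (hW2 : W2 = bary A B C ((2 * φ + 1) ^ 2 / u) (φ ^ 2 / v) ((φ + 1) ^ 2 / w))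
    (hW3 : W3 = bary A B C ((2 * φ + 1) ^ 2 / u) ((3 * φ + 2) ^ 2 / v) ((φ + 1) ^ 2 / w))
    (hV : AffineIndependent ℝ ![V1, V2, V3]) (hW : AffineIndependent ℝ ![W1, W2, W3])
    (O1 O2 K1 K2 : EuclideanSpace ℝ (Fin 2))
    (hO1 : O1 = (⟨![V1, V2, V3], hV⟩ : Affine.Triangle ℝ (EuclideanSpace ℝ (Fin 2))).circumcenter)
    (hO2 : O2 = (⟨![W1, W2, W3], hW⟩ : Affine.Triangle ℝ (EuclideanSpace ℝ (Fin 2))).circumcenter)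
    (hK1 : K1 = bary V1 V2 V3 ((dist V2 V3) ^ 2) ((dist V3 V1) ^ 2) ((dist V1 V2) ^ 2))
    (hK2 : K2 = bary W1 W2 W3 ((dist W2 W3) ^ 2) ((dist W3 W1) ^ 2) ((dist W1 W2) ^ 2)) :
    diamCircle O1 K1 = diamCircle O2 K2 ∧ diamCircle O1 K1 = diamCircle I Ge := by
  have h₁ := dist_lt_dist_add_dist_of_affineIndependent hABC
  have h₂ := dist_lt_dist_add_dist_of_affineIndependent hABC.comm_left
  have h₃ := dist_lt_dist_add_dist_of_affineIndependent hABC.comm_right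
  rw [dist_comm A C] at h₁ h₃
  rw [dist_comm B A, dist_comm A C] at h₂
  rw [dist_comm C B] at h₃
  have hu0 : 0 < u := by linarith
  have hv0 : 0 < v := by linarith
  have hw0 : 0 < w := by linarith
  have ha' : dist B C = v + w := by linarith
  have hb' : dist C A = w + u := by linarith
  have hc' : dist A B = u + v := by linarith
  have hI' : I = bary A B C (v + w) (w + u) (u + v) := by rw [hI, ha, hb, hc, ha', hb', hc']
  have h5 : √5 ^ 2 = 5 := Real.sq_sqrt (by norm_num)
  have hφ2 : φ ^ 2 = φ + 1 := by rw [hφ]; linear_combination h5 / 4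
  have h5lt : √5 < 2.24 := by rw [Real.sqrt_lt' (by norm_num)]; norm_num
  have hφ0 : 0 < φ := by rw [hφ]; positivity
  have hφlt : φ < 1.62 := by linarith
  have eV1 : V1 = inconicPoint A B C u v w φ (-1) := by
    rw [hV1, inconicPoint]; congr 1; ring
  have eV2 : V2 = inconicPoint A B C u v w (2 - φ) (-1) := by
    rw [hV2, inconicPoint]; congr 1 <;> ring
  have eV3 : V3 = inconicPoint A B C u v w (2 - φ) (2 * φ - 3) := by
    rw [hV3, inconicPoint]; congr 1 <;> ring
  have eW1 : W1 = inconicPoint A B C u v w 1 φ := by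
    rw [hW1, inconicPoint]; congr 1 <;> ring
  have eW2 : W2 = inconicPoint A B C u v w (2 * φ + 1) (-φ) := by
    rw [hW2, inconicPoint]; congr 1 <;> ring
  have eW3 : W3 = inconicPoint A B C u v w (2 * φ + 1) (-(3 * φ + 2)) := by
    rw [hW3, inconicPoint]; congr 1 <;> ring
  have hp₁ : 2 - φ ≠ 0 := by linarith
  have hp₂ : 2 * φ + 1 ≠ 0 := by positivity
  have eO1 : O1 = I := by
    rw [hO1, hI']
    refine circumcenter_inconicPoint (p := ![φ, 2 - φ, 2 - φ]) (q := ![-1, -1, 2 * φ - 3])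
      hu0 hv0 hw0 ha' hb' hc' ?_ _ ?_
    · simp [Fin.forall_fin_succ, hφ0.ne', hp₁]
    · simp [Fin.forall_fin_succ, eV1, eV2, eV3]
  have eO2 : O2 = I := by
    rw [hO2, hI']
    refine circumcenter_inconicPoint (p := ![1, 2 * φ + 1, 2 * φ + 1])
      (q := ![φ, -φ, -(3 * φ + 2)]) hu0 hv0 hw0 ha' hb' hc' ?_ _ ?_
    · simp [Fin.forall_fin_succ, hp₂]
    · simp [Fin.forall_fin_succ, eW1, eW2, eW3]
  have eK1 : K1 = Ge := by
    rw [hK1, hGe]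
    refine symmedian_inconicPoint (m := 208 - 128 * φ) hu0 hv0 hw0 ha' hb' hc'
      hφ0.ne' hp₁ hp₁ (by linarith) ?_ ?_ ?_ eV1 eV2 eV3 <;> grind
  have eK2 : K2 = Ge := by
    rw [hK2, hGe]
    refine symmedian_inconicPoint (m := 4 * (φ ^ 10 + φ ^ 12 + φ ^ 14)) hu0 hv0 hw0 ha' hb' hc'
      one_ne_zero hp₂ hp₂ (by positivity) ?_ ?_ ?_ eW1 eW2 eW3 <;> grind
  rw [eO1, eO2, eK1, eK2]
  exact ⟨rfl, rfl⟩
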